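/- Let Ω = B₁ ⊆ ℝⁿ, Ω± = B₁∩{±xₙ>0}, Γ = B₁∩{xₙ=0}. Let H₋ be a degenerate elliptic second-order operator on Ω₋∪Γ and H₊ a degenerate elliptic second-order operator on Ω₊∪Γ that is uniformly elliptic with respect to some [λ,Λ] ⊆ (0,∞). Let u ∈ C(B₁) be a viscosity sub-solution of the relaxed transmission problem. Then for every r ∈ (0,1) and every φ ∈ C(B_r) whose restrictions φ₋ to B_r∩{xₙ≤0} and φ₊ to B_r∩{xₙ≥0} are C² up to Γ, if φ touches u from above at 0 ∈ Γ on B_r, then min( H₋(D²φ₊(0), Dφ₊(0), φ(0), 0), ∂ₙφ₋(0) − ∂ₙφ₊(0) ) ≤ 0. -/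

import Mathlib

open Metric Set Filter Topology Bornology

noncomputable section

abbrev Euc (n : ℕ) := EuclideanSpace ℝ (Fin n)

/-- Hessian matrix of a function at a point (second iterated Fréchet derivative,
a purely local notion). -/
def hessianMatrix {n : ℕ} (φ : Euc n → ℝ) (x : Euc n) : Matrix (Fin n) (Fin n) ℝ :=
  Matrix.of fun i j =>
    iteratedFDeriv ℝ 2 φ x ![EuclideanSpace.single i (1 : ℝ), EuclideanSpace.single j (1 : ℝ)]

/-- Evaluation of a second-order operator on a C² function. -/
def evalOp2 {n : ℕ} (H : Matrix (Fin n) (Fin n) ℝ → Euc n → ℝ → Euc n → ℝ)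
    (φ : Euc n → ℝ) (x : Euc n) : ℝ :=
  H (hessianMatrix φ x) (gradient φ x) (φ x) x

/-- Degenerate ellipticity of a second-order operator on `S`. -/
def DegElliptic2 {n : ℕ} (S : Set (Euc n))
    (H : Matrix (Fin n) (Fin n) ℝ → Euc n → ℝ → Euc n → ℝ) : Prop :=
  ∀ M₁ M₂ : Matrix (Fin n) (Fin n) ℝ, ∀ p : Euc n, ∀ z₁ z₂ : ℝ, ∀ x ∈ S,
    (M₁ - M₂).PosSemidef → z₁ ≤ z₂ → H M₁ p z₁ x ≤ H M₂ p z₂ x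

/-- Continuity of a second-order operator on `Sym × ℝⁿ × ℝ × S`. -/
def ContinuousOp2 {n : ℕ} (S : Set (Euc n))
    (H : Matrix (Fin n) (Fin n) ℝ → Euc n → ℝ → Euc n → ℝ) : Prop :=
  ContinuousOn
    (fun q : (Matrix (Fin n) (Fin n) ℝ) × Euc n × ℝ × Euc n => H q.1 q.2.1 q.2.2.1 q.2.2.2)
    (univ ×ˢ univ ×ˢ univ ×ˢ S)

/-- The set of symmetric matrices `A` with `λ I ≤ A ≤ Λ I`. -/
def pucciSet (n : ℕ) (l L : ℝ) : Set (Matrix (Fin n) (Fin n) ℝ) :=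
  {A | (A - l • (1 : Matrix (Fin n) (Fin n) ℝ)).PosSemidef ∧
       ((L • (1 : Matrix (Fin n) (Fin n) ℝ)) - A).PosSemidef}

/-- Pucci maximal operator `𝓜⁺_{λ,Λ}`. -/
def pucciPlus {n : ℕ} (l L : ℝ) (M : Matrix (Fin n) (Fin n) ℝ) : ℝ :=
  sSup ((fun A : Matrix (Fin n) (Fin n) ℝ => -(A * M).trace) '' pucciSet n l L)

/-- Pucci minimal operator `𝓜⁻_{λ,Λ}`. -/
def pucciMinus {n : ℕ} (l L : ℝ) (M : Matrix (Fin n) (Fin n) ℝ) : ℝ :=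
  sInf ((fun A : Matrix (Fin n) (Fin n) ℝ => -(A * M).trace) '' pucciSet n l L)

/-- Uniform ellipticity of a second-order operator with respect to `[λ, Λ]` on `S`. -/
def UnifElliptic2 {n : ℕ} (l L : ℝ) (S : Set (Euc n))
    (H : Matrix (Fin n) (Fin n) ℝ → Euc n → ℝ → Euc n → ℝ) : Prop :=
  ∀ M₁ M₂ : Matrix (Fin n) (Fin n) ℝ, ∀ p₁ p₂ : Euc n, ∀ z₁ z₂ : ℝ, ∀ x ∈ S,
    pucciMinus l L (M₂ - M₁) - L * ‖p₂ - p₁‖ - L * max (-(z₂ - z₁)) 0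
        ≤ H M₂ p₂ z₂ x - H M₁ p₁ z₁ x ∧
      H M₂ p₂ z₂ x - H M₁ p₁ z₁ x
        ≤ pucciPlus l L (M₂ - M₁) + L * ‖p₂ - p₁‖ + L * max (z₂ - z₁) 0

/-- `φ` is an admissible C² test function touching `u` from above at `x₀` on `ball x₀ r ⊆ Ω`. -/
def SubTest {n : ℕ} (Ω : Set (Euc n)) (u : Euc n → ℝ) (x₀ : Euc n)
    (φ : Euc n → ℝ) (r : ℝ) : Prop :=
  0 < r ∧ ball x₀ r ⊆ Ω ∧ ContDiffOn ℝ 2 φ (ball x₀ r) ∧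
    (∀ x ∈ ball x₀ r, u x ≤ φ x) ∧ u x₀ = φ x₀

/-- `φ` is an admissible C² test function touching `u` from below at `x₀` on `ball x₀ r ⊆ Ω`. -/
def SupTest {n : ℕ} (Ω : Set (Euc n)) (u : Euc n → ℝ) (x₀ : Euc n)
    (φ : Euc n → ℝ) (r : ℝ) : Prop :=
  0 < r ∧ ball x₀ r ⊆ Ω ∧ ContDiffOn ℝ 2 φ (ball x₀ r) ∧
    (∀ x ∈ ball x₀ r, φ x ≤ u x) ∧ u x₀ = φ x₀

/-- Viscosity sub-solution of the relaxed transmission problem (both operators second-order). -/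
def RelaxedSub2 {n : ℕ} (Ω Ωm Ωp Γ : Set (Euc n))
    (Hm Hp : Matrix (Fin n) (Fin n) ℝ → Euc n → ℝ → Euc n → ℝ) (u : Euc n → ℝ) : Prop :=
  ∀ x₀ : Euc n, ∀ φ : Euc n → ℝ, ∀ r : ℝ, SubTest Ω u x₀ φ r →
    (x₀ ∈ Ωm → evalOp2 Hm φ x₀ ≤ 0) ∧ (x₀ ∈ Ωp → evalOp2 Hp φ x₀ ≤ 0) ∧
      (x₀ ∈ Γ → min (evalOp2 Hm φ x₀) (evalOp2 Hp φ x₀) ≤ 0)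

/-- Viscosity super-solution of the relaxed transmission problem (both operators second-order). -/
def RelaxedSuper2 {n : ℕ} (Ω Ωm Ωp Γ : Set (Euc n))
    (Hm Hp : Matrix (Fin n) (Fin n) ℝ → Euc n → ℝ → Euc n → ℝ) (u : Euc n → ℝ) : Prop :=
  ∀ x₀ : Euc n, ∀ φ : Euc n → ℝ, ∀ r : ℝ, SupTest Ω u x₀ φ r →
    (x₀ ∈ Ωm → 0 ≤ evalOp2 Hm φ x₀) ∧ (x₀ ∈ Ωp → 0 ≤ evalOp2 Hp φ x₀) ∧
      (x₀ ∈ Γ → 0 ≤ max (evalOp2 Hm φ x₀) (evalOp2 Hp φ x₀))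

/-- Gradient within a set, as a vector of `ℝⁿ`. -/
def gradWithinE {n : ℕ} (S : Set (Euc n)) (φ : Euc n → ℝ) (x : Euc n) : Euc n :=
  (EuclideanSpace.equiv (Fin n) ℝ).symm fun i =>
    fderivWithin ℝ φ S x (EuclideanSpace.single i (1 : ℝ))

/-- Hessian matrix within a set. -/
def hessWithinE {n : ℕ} (S : Set (Euc n)) (φ : Euc n → ℝ) (x : Euc n) :
    Matrix (Fin n) (Fin n) ℝ :=
  Matrix.of fun i j =>
    fderivWithin ℝ (fun y => fderivWithin ℝ φ S y) S x (EuclideanSpace.single i (1 : ℝ))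
      (EuclideanSpace.single j (1 : ℝ))

/-- Normal (last-coordinate) derivative within a set. -/
def dnWithin {n : ℕ} (S : Set (Euc (n + 1))) (φ : Euc (n + 1) → ℝ) (x : Euc (n + 1)) : ℝ :=
  fderivWithin ℝ φ S x (EuclideanSpace.single (Fin.last n) (1 : ℝ))

/-- `B₁ ∩ {xₙ < 0}`. -/
def flatOmegaM (n : ℕ) : Set (Euc (n + 1)) := ball 0 1 ∩ {x | x (Fin.last n) < 0}
/-- `B₁ ∩ {xₙ > 0}`. -/
def flatOmegaP (n : ℕ) : Set (Euc (n + 1)) := ball 0 1 ∩ {x | 0 < x (Fin.last n)}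
/-- `B₁ ∩ {xₙ = 0}`. -/
def flatGamma (n : ℕ) : Set (Euc (n + 1)) := ball 0 1 ∩ {x | x (Fin.last n) = 0}
/-- `B₁ ∩ {xₙ ≤ 0}`. -/
def flatSm (n : ℕ) : Set (Euc (n + 1)) := ball 0 1 ∩ {x | x (Fin.last n) ≤ 0}
/-- `B₁ ∩ {xₙ ≥ 0}`. -/
def flatSp (n : ℕ) : Set (Euc (n + 1)) := ball 0 1 ∩ {x | 0 ≤ x (Fin.last n)}

/-- Derivative of a quadratic polynomial with symmetric second-order part. -/
theorem hasFDerivAt_quadratic {E : Type*} [NormedAddCommGroup E] [NormedSpace ℝ E]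
    (c : ℝ) (l : E →L[ℝ] ℝ) (B : E →L[ℝ] E →L[ℝ] ℝ) (hB : ∀ v w, B v w = B w v) (x : E) :
    HasFDerivAt (fun y => c + l y + 1 / 2 * B y y) (l + B x) x := by
  have h1 : HasFDerivAt (fun y => B y y) _ x := B.hasFDerivAt.clm_apply (hasFDerivAt_id x)
  have h2 := (l.hasFDerivAt (x := x)).const_add c |>.add (h1.const_mul (1 / 2))
  refine h2.congr_fderiv ?_
  ext v
  simp [hB v x]
  ring

theorem contDiff_quadratic {E : Type*} [NormedAddCommGroup E] [NormedSpace ℝ E]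
    {k : WithTop ℕ∞} (c : ℝ) (l : E →L[ℝ] ℝ) (B : E →L[ℝ] E →L[ℝ] ℝ) :
    ContDiff ℝ k (fun y => c + l y + 1 / 2 * B y y) := by
  have h : ContDiff ℝ k (fun y => B y y) := B.contDiff.clm_apply contDiff_id
  exact (contDiff_const.add l.contDiff).add (contDiff_const.mul h)

theorem fderiv_quadratic {E : Type*} [NormedAddCommGroup E] [NormedSpace ℝ E]
    (c : ℝ) (l : E →L[ℝ] ℝ) (B : E →L[ℝ] E →L[ℝ] ℝ) (hB : ∀ v w, B v w = B w v) :
    fderiv ℝ (fun y => c + l y + 1 / 2 * B y y) = fun x => l + B x :=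
  funext fun x => (hasFDerivAt_quadratic c l B hB x).fderiv

theorem hessianMatrix_quadratic {n : ℕ} (c : ℝ) (l : Euc n →L[ℝ] ℝ)
    (B : Euc n →L[ℝ] Euc n →L[ℝ] ℝ) (hB : ∀ v w, B v w = B w v) (x : Euc n) :
    hessianMatrix (fun y => c + l y + 1 / 2 * B y y) x =
      Matrix.of fun i j => B (EuclideanSpace.single i 1) (EuclideanSpace.single j 1) := by
  ext i j
  have h : HasFDerivAt (fun x => l + B x) B x := B.hasFDerivAt.const_add l
  rw [hessianMatrix, Matrix.of_apply, iteratedFDeriv_two_apply, fderiv_quadratic c l B hB,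
    h.fderiv]
  rfl

theorem gradient_apply_eq_fderiv {n : ℕ} (f : Euc n → ℝ) (x : Euc n) (i : Fin n) :
    gradient f x i = fderiv ℝ f x (EuclideanSpace.single i 1) := by
  have h : inner ℝ (gradient f x) (EuclideanSpace.single i (1 : ℝ)) =
      fderiv ℝ f x (EuclideanSpace.single i 1) := by
    simp [gradient]
  rw [← h, EuclideanSpace.inner_single_right]
  simp

/-- A `C¹` function on a convex set is strictly differentiable within it. -/
theorem ContDiffOn.exists_norm_sub_sub_fderivWithin_le {E : Type*} [NormedAddCommGroup E]
    [NormedSpace ℝ E] {S : Set E} {f : E → ℝ} {x₀ : E} (hf : ContDiffOn ℝ 1 f S)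
    (hS : Convex ℝ S) (hU : UniqueDiffOn ℝ S) (hx₀ : x₀ ∈ S) {ε : ℝ} (hε : 0 < ε) :
    ∃ δ > 0, ∀ x ∈ S ∩ ball x₀ δ, ∀ y ∈ S ∩ ball x₀ δ,
      ‖f y - f x - fderivWithin ℝ f S x₀ (y - x)‖ ≤ ε * ‖y - x‖ := by
  have hc := (hf.continuousOn_fderivWithin hU le_rfl) x₀ hx₀
  obtain ⟨δ, hδ, h⟩ := Metric.continuousWithinAt_iff.1 hc ε hε
  refine ⟨δ, hδ, fun x hx y hy => ?_⟩
  refine Convex.norm_image_sub_le_of_norm_hasFDerivWithin_le' (s := S ∩ ball x₀ δ)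
    (f' := fderivWithin ℝ f S) (fun z hz => ?_) (fun z hz => ?_)
    (hS.inter (convex_ball _ _)) hx hy
  · exact ((hf.differentiableOn one_ne_zero z hz.1).hasFDerivWithinAt).mono inter_subset_left
  · rw [← dist_eq_norm]
    exact (h hz.1 hz.2).le

/-- Second-order Taylor expansion at the origin of a `C²` function on a convex set. -/
theorem ContDiffOn.exists_taylor_two_le {E : Type*} [NormedAddCommGroup E]
    [NormedSpace ℝ E] {S : Set E} {f : E → ℝ} (hf : ContDiffOn ℝ 2 f S)
    (hS : Convex ℝ S) (hU : UniqueDiffOn ℝ S) (h0 : (0 : E) ∈ S)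
    (hsymm : IsSymmSndFDerivWithinAt ℝ f S 0) {ε : ℝ} (hε : 0 < ε) :
    ∃ δ > 0, ∀ x ∈ S ∩ ball 0 δ,
      ‖f x - (f 0 + fderivWithin ℝ f S 0 x +
        1 / 2 * fderivWithin ℝ (fderivWithin ℝ f S) S 0 x x)‖ ≤ ε * ‖x‖ ^ 2 := by
  set F := fderivWithin ℝ f S with hF
  set L := fderivWithin ℝ F S 0 with hL
  have hd : HasFDerivWithinAt F L S 0 :=
    (((hf.fderivWithin hU (m := 1) (by norm_num)).differentiableOn one_ne_zero) 0
      h0).hasFDerivWithinAt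
  have ho := hd.isLittleO.def hε
  obtain ⟨δ, hδ, h⟩ := Metric.mem_nhdsWithin_iff.1 ho
  refine ⟨δ, hδ, fun x hx => ?_⟩
  have hxδ : ‖x‖ < δ := by simpa using hx.2
  have key := Convex.norm_image_sub_le_of_norm_hasFDerivWithin_le
    (f := fun y => f y - (f 0 + F 0 y + 1 / 2 * L y y)) (f' := fun y => F y - (F 0 + L y))
    (s := S ∩ closedBall 0 ‖x‖) (C := ε * ‖x‖) (x := 0) (y := x) (fun z hz => ?_)
    (fun z hz => ?_) (hS.inter (convex_closedBall _ _)) ⟨h0, by simp⟩ ⟨hx.1, by simp⟩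
  · simpa [pow_two, mul_assoc] using key
  · exact ((hf.differentiableOn two_ne_zero z hz.1).hasFDerivWithinAt.sub
      (hasFDerivAt_quadratic _ _ _ hsymm z).hasFDerivWithinAt).mono inter_subset_left
  · have hz' : ‖z‖ ≤ ‖x‖ := by simpa using hz.2
    have := h ⟨by simpa using hz'.trans_lt hxδ, hz.1⟩
    simp only [mem_ofPred_eq, sub_zero] at this
    rw [← sub_sub]
    exact this.trans (by gcongr)

theorem le_apply_of_mem_pucciSet {n : ℕ} {l L : ℝ} {A : Matrix (Fin n) (Fin n) ℝ}
    (hA : A ∈ pucciSet n l L) (i : Fin n) : l ≤ A i i := by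
  have := hA.1.diag_nonneg (i := i)
  simpa using this

/-- Lower Pucci bound for a nonpositive multiple of a coordinate projection. -/
theorem le_pucciMinus_neg_smul_single {n : ℕ} {l L : ℝ} (hlL : l ≤ L) {k : ℝ} (hk : 0 ≤ k)
    (i : Fin n) : k * l ≤ pucciMinus l L (-(k • Matrix.single i i (1 : ℝ))) := by
  refine le_csInf (Set.Nonempty.image _ ⟨l • 1, ?_, ?_⟩) ?_
  · simpa using Matrix.PosSemidef.zero
  · rw [← sub_smul]
    exact Matrix.PosSemidef.one.smul (sub_nonneg.2 hlL)
  · rintro _ ⟨A, hA, rfl⟩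
    have := le_apply_of_mem_pucciSet hA i
    simp only [Matrix.mul_neg, Matrix.trace_neg, neg_neg, Matrix.mul_smul, Matrix.trace_smul,
      Matrix.trace_mul_single, MulOpposite.op_one, one_smul, smul_eq_mul]
    gcongr

theorem posSemidef_single_self {n : ℕ} (i : Fin n) :
    (Matrix.single i i (1 : ℝ)).PosSemidef := by
  rw [← Matrix.diagonal_single]
  refine Matrix.PosSemidef.diagonal ?_
  exact Pi.single_nonneg.2 zero_le_one

/-- The tangential projection onto a coordinate hyperplane does not increase the norm. -/
theorem norm_sub_smul_single_le {n : ℕ} (x : Euc n) (i : Fin n) :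
    ‖x - x i • EuclideanSpace.single i (1 : ℝ)‖ ≤ ‖x‖ := by
  refine abs_le_of_sq_le_sq' ?_ (norm_nonneg _) |>.2
  rw [norm_sub_sq_real, real_inner_smul_right, EuclideanSpace.inner_single_right, norm_smul]
  simp
  nlinarith [sq_nonneg (x i)]

theorem convex_ball_inter_half {n : ℕ} (r : ℝ) (l : Euc n →L[ℝ] ℝ) :
    Convex ℝ (ball (0 : Euc n) r ∩ {x | 0 ≤ l x}) :=
  (convex_ball _ _).inter (convex_halfSpace_ge l.isBoundedLinearMap.toIsLinearMap 0)

theorem zero_mem_closure_interior_half {n : ℕ} {r : ℝ} (hr : 0 < r) (l : Euc n →L[ℝ] ℝ)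
    {v : Euc n} (hv : 0 < l v) :
    (0 : Euc n) ∈ closure (interior (ball (0 : Euc n) r ∩ {x | 0 ≤ l x})) := by
  have hsub : ball (0 : Euc n) r ∩ {x | 0 < l x} ⊆
      interior (ball (0 : Euc n) r ∩ {x | 0 ≤ l x}) :=
    interior_maximal (inter_subset_inter_right _ fun x (hx : 0 < l x) => hx.le)
      (isOpen_ball.inter (isOpen_lt continuous_const l.continuous))
  refine closure_mono hsub ?_
  have ht : Tendsto (fun t : ℝ => t • v) (𝓝[>] 0) (𝓝 0) := by
    have : Continuous fun t : ℝ => t • v := by fun_prop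
    simpa using (this.tendsto 0).mono_left nhdsWithin_le_nhds
  refine mem_closure_of_tendsto ht ?_
  filter_upwards [ht (ball_mem_nhds 0 hr), self_mem_nhdsWithin] with t h1 h2
  exact ⟨h1, by simpa using mul_pos h2 hv⟩

theorem uniqueDiffOn_ball_inter_half {n : ℕ} {r : ℝ} (hr : 0 < r) (l : Euc n →L[ℝ] ℝ)
    {v : Euc n} (hv : 0 < l v) :
    UniqueDiffOn ℝ (ball (0 : Euc n) r ∩ {x | 0 ≤ l x}) :=
  uniqueDiffOn_convex (convex_ball_inter_half r l)
    (closure_nonempty_iff.1 ⟨0, zero_mem_closure_interior_half hr l hv⟩)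

/-- A concave kink of size `a` at the interface dominates a small linear slope `t` together with a
quadratic bending `K`, as long as `K * |s|` is small. -/
theorem kink_le_bending {a t K s A A' b fx fy gx gy : ℝ} (hs : s ≤ 0) (ha : A - A' = a)
    (hta : t ≤ a / 4) (hK : K * (-s) ≤ a / 2)
    (hf : fx - fy - s * A ≤ a / 8 * (-s)) (hg : -(a / 8 * (-s)) ≤ gx - gy - s * A')
    (hfg : fy ≤ gy + b) : fx ≤ gx + b + t * s - K * s ^ 2 := by
  have h : 0 ≤ (-s) * (3 * a / 4 - t + K * s) := mul_nonneg (by linarith) (by linarith)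
  subst ha
  linarith

set_option maxHeartbeats 1000000 in
theorem statement_2 {n : ℕ} (lam Lam : ℝ) (hlam : 0 < lam) (hLam : lam ≤ Lam)
    (Hm Hp : Matrix (Fin (n + 1)) (Fin (n + 1)) ℝ → Euc (n + 1) → ℝ → Euc (n + 1) → ℝ)
    (hHmDE : DegElliptic2 (flatOmegaM n ∪ flatGamma n) Hm)
    (hHmC : ContinuousOp2 (flatOmegaM n ∪ flatGamma n) Hm)
    (hHpDE : DegElliptic2 (flatOmegaP n ∪ flatGamma n) Hp)
    (hHpC : ContinuousOp2 (flatOmegaP n ∪ flatGamma n) Hp)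
    (hHpUE : UnifElliptic2 lam Lam (flatOmegaP n ∪ flatGamma n) Hp)
    (u : Euc (n + 1) → ℝ) (hu : ContinuousOn u (ball 0 1))
    (husub : RelaxedSub2 (ball 0 1) (flatOmegaM n) (flatOmegaP n) (flatGamma n) Hm Hp u)
    (r : ℝ) (hr : r ∈ Ioo (0 : ℝ) 1)
    (φ : Euc (n + 1) → ℝ) (hφc : ContinuousOn φ (ball 0 r))
    (hφm : ContDiffOn ℝ 2 φ (ball 0 r ∩ {x | x (Fin.last n) ≤ 0}))
    (hφp : ContDiffOn ℝ 2 φ (ball 0 r ∩ {x | 0 ≤ x (Fin.last n)}))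
    (htouch : ∀ x ∈ ball (0 : Euc (n + 1)) r, u x ≤ φ x) (heq : u 0 = φ 0) :
    min (Hm (hessWithinE (ball 0 r ∩ {x | 0 ≤ x (Fin.last n)}) φ 0)
          (gradWithinE (ball 0 r ∩ {x | 0 ≤ x (Fin.last n)}) φ 0) (φ 0) 0)
        (dnWithin (ball 0 r ∩ {x | x (Fin.last n) ≤ 0}) φ 0 -
          dnWithin (ball 0 r ∩ {x | 0 ≤ x (Fin.last n)}) φ 0) ≤ 0 := by
  by_contra! hcon
  obtain ⟨hH, hdn⟩ := lt_min_iff.1 hcon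
  obtain ⟨hr0, hr1⟩ := hr
  set e : Euc (n + 1) := EuclideanSpace.single (Fin.last n) (1 : ℝ) with he
  let P : Euc (n + 1) →L[ℝ] ℝ := EuclideanSpace.proj (Fin.last n)
  have hP : ∀ x, P x = x (Fin.last n) := fun x => rfl
  have hPe : P e = 1 := by simp [hP, he]
  set Sp := ball (0 : Euc (n + 1)) r ∩ {x | 0 ≤ x (Fin.last n)} with hSp
  set Sm := ball (0 : Euc (n + 1)) r ∩ {x | x (Fin.last n) ≤ 0} with hSm
  have hSm' : Sm = ball (0 : Euc (n + 1)) r ∩ {x | 0 ≤ (-P) x} := by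
    simp [hSm, hP]
  have hPp : 0 < P e := by simp [hPe]
  have hPm : 0 < (-P) (-e) := by simp [hPe]
  have hcvp : Convex ℝ Sp := convex_ball_inter_half r P
  have hcvm : Convex ℝ Sm := hSm' ▸ convex_ball_inter_half r (-P)
  have hUp : UniqueDiffOn ℝ Sp := uniqueDiffOn_ball_inter_half hr0 P hPp
  have hUm : UniqueDiffOn ℝ Sm := hSm' ▸ uniqueDiffOn_ball_inter_half hr0 (-P) hPm
  have h0p : (0 : Euc (n + 1)) ∈ Sp := by simp [hSp, hr0]
  have h0m : (0 : Euc (n + 1)) ∈ Sm := by simp [hSm, hr0]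
  have h0Γ : (0 : Euc (n + 1)) ∈ flatGamma n := by simp [flatGamma]
  have hsymm : IsSymmSndFDerivWithinAt ℝ φ Sp 0 :=
    (hφp 0 h0p).isSymmSndFDerivWithinAt (by simp) hUp
      (zero_mem_closure_interior_half hr0 P hPp) h0p
  set F := fderivWithin ℝ φ Sp 0 with hF
  set G := fderivWithin ℝ φ Sm 0 with hG
  set L := fderivWithin ℝ (fderivWithin ℝ φ Sp) Sp 0 with hL
  set M := hessWithinE Sp φ 0 with hM
  set p := gradWithinE Sp φ 0 with hp
  set a : ℝ := G e - F e with ha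
  have ha0 : 0 < a := hdn
  -- a small perturbation `t` keeps the lower operator positive
  obtain ⟨t, ht0, hta, htH⟩ : ∃ t : ℝ, 0 < t ∧ t ≤ a / 4 ∧
      0 < Hm (M + (2 * t) • 1) (p + t • e) (φ 0) 0 := by
    have hc : Continuous fun t : ℝ => Hm (M + (2 * t) • 1) (p + t • e) (φ 0) 0 := by
      have := hHmC.comp_continuous
        (f := fun t : ℝ => (M + (2 * t) • (1 : Matrix (Fin (n + 1)) (Fin (n + 1)) ℝ),
          p + t • e, φ 0, (0 : Euc (n + 1)))) (by fun_prop)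
        (fun t => ⟨mem_univ _, mem_univ _, mem_univ _, Or.inr h0Γ⟩)
      exact this
    have h1 : ∀ᶠ t in 𝓝[>] (0 : ℝ), 0 < Hm (M + (2 * t) • 1) (p + t • e) (φ 0) 0 :=
      nhdsWithin_le_nhds (hc.continuousAt.eventually_const_lt (by simpa using hH))
    have h2 : ∀ᶠ t in 𝓝[>] (0 : ℝ), t ≤ a / 4 :=
      nhdsWithin_le_nhds (eventually_le_nhds (by positivity))
    obtain ⟨t, ⟨h1, h2⟩, h3⟩ := ((h1.and h2).and self_mem_nhdsWithin).exists
    exact ⟨t, h3, h2, h1⟩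
  -- a large concavity `K` in the normal direction makes the upper operator positive
  obtain ⟨K, hK0, hKH⟩ : ∃ K : ℝ, 0 < K ∧
      0 < Hp (M + (2 * t) • 1) (p + t • e) (φ 0) 0 + 2 * K * lam := by
    set v := Hp (M + (2 * t) • 1) (p + t • e) (φ 0) 0
    refine ⟨(|v| + 1) / lam, by positivity, ?_⟩
    have : 2 * ((|v| + 1) / lam) * lam = 2 * (|v| + 1) := by field_simp
    rw [this]
    linarith [neg_abs_le v, abs_nonneg v]
  let B : Euc (n + 1) →L[ℝ] Euc (n + 1) →L[ℝ] ℝ :=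
    L + (2 * t) • (∑ i, (EuclideanSpace.proj (𝕜 := ℝ) i).smulRight (EuclideanSpace.proj i)) -
      (2 * K) • P.smulRight P
  let l : Euc (n + 1) →L[ℝ] ℝ := F + t • P
  have hBapp : ∀ v w, B v w = L v w + 2 * t * inner ℝ v w - 2 * K * (P v * P w) := by
    intro v w
    simp [B, PiLp.inner_apply, mul_comm]
  have hBs : ∀ v w, B v w = B w v := by
    intro v w
    rw [hBapp, hBapp, hsymm v w, real_inner_comm, mul_comm (P v)]
  let q : Euc (n + 1) → ℝ := fun x => φ 0 + F x + 1 / 2 * L x x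
  let ψ : Euc (n + 1) → ℝ := fun x => φ 0 + l x + 1 / 2 * B x x
  have hψq : ∀ x, ψ x = q x + t * ‖x‖ ^ 2 + t * P x - K * P x ^ 2 := by
    intro x
    simp only [ψ, q, hBapp, real_inner_self_eq_norm_sq, l, add_apply,
      smul_apply, smul_eq_mul]
    ring
  have hψ0 : ψ 0 = φ 0 := by simp [ψ]
  have hhess : hessianMatrix ψ 0 =
      M + (2 * t) • 1 - (2 * K) • Matrix.single (Fin.last n) (Fin.last n) 1 := by
    rw [hessianMatrix_quadratic _ _ _ hBs]
    ext i j
    simp only [Matrix.of_apply, hBapp, Matrix.sub_apply, Matrix.add_apply, Matrix.smul_apply,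
      Matrix.one_apply, Matrix.single_apply, hM, hessWithinE, smul_eq_mul, hP]
    congr 2
    · simp [EuclideanSpace.inner_single_left]
    · simp [← ite_and, and_comm]
  have hgrad : gradient ψ 0 = p + t • e := by
    ext i
    rw [gradient_apply_eq_fderiv, fderiv_quadratic _ _ _ hBs]
    simp [l, hp, gradWithinE, he, hP, eq_comm, hF]
  -- `ψ` touches `u` from above near the origin
  obtain ⟨δ₁, hδ₁, hT⟩ := hφp.exists_taylor_two_le hcvp hUp h0p hsymm ht0
  obtain ⟨δ₂, hδ₂, hφ1⟩ := (hφm.of_le (by norm_num)).exists_norm_sub_sub_fderivWithin_le hcvm hUm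
    h0m (ε := a / 8) (by positivity)
  obtain ⟨δ₃, hδ₃, hq1⟩ := (contDiff_quadratic (k := 1) (φ 0) F L).contDiffOn
    |>.exists_norm_sub_sub_fderivWithin_le convex_univ uniqueDiffOn_univ
    (mem_univ (0 : Euc (n + 1))) (ε := a / 8) (by positivity)
  have hq0 : fderivWithin ℝ (fun y => φ 0 + F y + 1 / 2 * L y y) univ 0 = F := by
    rw [fderivWithin_univ, fderiv_quadratic _ _ _ hsymm]
    simp
  rw [hq0] at hq1
  obtain ⟨ρ, hρ0, hρr, hρ1, hρ2, hρ3, hρ4, hρ5⟩ : ∃ ρ : ℝ, 0 < ρ ∧ ρ ≤ r ∧ ρ ≤ δ₁ ∧ ρ ≤ δ₂ ∧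
      ρ ≤ δ₃ ∧ ρ ≤ t / K ∧ ρ ≤ a / 2 / K := by
    refine ⟨min r (min δ₁ (min δ₂ (min δ₃ (min (t / K) (a / 2 / K))))), by positivity, ?_⟩
    simp
  rw [le_div_iff₀ hK0] at hρ4 hρ5
  have htest : SubTest (ball 0 1) u 0 ψ ρ := by
    refine ⟨hρ0, ball_subset_ball (by linarith), (contDiff_quadratic _ _ _).contDiffOn,
      fun x hx => ?_, by rw [hψ0, heq]⟩
    have hxr : x ∈ ball (0 : Euc (n + 1)) r := ball_subset_ball hρr hx
    refine (htouch x hxr).trans ?_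
    rw [hψq]
    have hxρ : ‖x‖ < ρ := by simpa using hx
    have hPx : |P x| ≤ ‖x‖ := PiLp.norm_apply_le x (Fin.last n)
    have hupper : ∀ y ∈ Sp, ‖y‖ < ρ → φ y ≤ q y + t * ‖y‖ ^ 2 := by
      intro y hy hyρ
      have := (le_abs_self _).trans (hT y ⟨hy, by simpa using hyρ.trans_le hρ1⟩)
      simp only [q]
      linarith
    rcases le_total 0 (P x) with hs | hs
    · have h1 := hupper x ⟨hxr, hs⟩ hxρ
      rw [abs_of_nonneg hs] at hPx
      have h2 : K * P x ≤ t := by nlinarith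
      have h3 : 0 ≤ P x * (t - K * P x) := mul_nonneg hs (by linarith)
      linarith
    · set y := x - P x • e with hy
      have hyx : ‖y‖ ≤ ‖x‖ := norm_sub_smul_single_le x (Fin.last n)
      have hPy : P y = 0 := by simp [hy, hPe]
      have hyρ : ‖y‖ < ρ := hyx.trans_lt hxρ
      have hyr : y ∈ ball (0 : Euc (n + 1)) r := by simpa using hyρ.trans_le hρr
      have hxy : x - y = P x • e := by simp [hy]
      have h1 := hupper y ⟨hyr, hPy.ge⟩ hyρ
      have h2 := hφ1 y ⟨⟨hyr, hPy.le⟩, by simpa using hyρ.trans_le hρ2⟩ x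
        ⟨⟨hxr, hs⟩, by simpa using hxρ.trans_le hρ2⟩
      have h3 := hq1 y ⟨mem_univ _, by simpa using hyρ.trans_le hρ3⟩ x
        ⟨mem_univ _, by simpa using hxρ.trans_le hρ3⟩
      have hne : ‖P x • e‖ = -P x := by
        rw [norm_smul, he]
        simp [abs_of_nonpos hs]
      rw [hxy, hne, map_smul, smul_eq_mul, Real.norm_eq_abs, abs_le] at h2 h3
      rw [abs_of_nonpos hs] at hPx
      have h5 : K * (-P x) ≤ a / 2 := by nlinarith
      have h6 : φ y ≤ q y + t * ‖x‖ ^ 2 := h1.trans (by gcongr)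
      exact kink_le_bending hs rfl hta h5 h2.2 h3.1 h6
  have hmin := (husub 0 ψ ρ htest).2.2 h0Γ
  refine absurd hmin (not_le.2 (lt_min ?_ ?_))
  · rw [evalOp2, hhess, hgrad, hψ0]
    refine htH.trans_le (hHmDE _ _ _ _ _ 0 (Or.inr h0Γ) ?_ le_rfl)
    rw [sub_sub_cancel]
    exact (posSemidef_single_self _).smul (by positivity)
  · rw [evalOp2, hhess, hgrad, hψ0]
    have h1 := (hHpUE (M + (2 * t) • 1)
      (M + (2 * t) • 1 - (2 * K) • Matrix.single (Fin.last n) (Fin.last n) 1)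
      (p + t • e) (p + t • e) (φ 0) (φ 0) 0 (Or.inr h0Γ)).1
    have h2 := le_pucciMinus_neg_smul_single hLam (k := 2 * K) (by positivity) (Fin.last n)
    rw [sub_sub_cancel_left] at h1
    simp only [sub_self, norm_zero, mul_zero, neg_zero, max_self, sub_zero] at h1
    linarith

end
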